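/- For every natural number d there exists a constant C_d > 0 with the following property: for every closed subset F of ℝ^d and every positive integer ν there exists a smooth function χ : ℝ^d → ℝ with values in [0,1] such that χ(x) = 1 whenever dist(x, F) ≥ 1/ν, χ vanishes on some open neighborhood of F, and the total derivative of χ satisfies ‖Dχ(x)‖ ≤ C_d · ν for every x ∈ ℝ^d. -/

import Mathlib

open MeasureTheory Metric in
/-- Averaging a Lipschitz function against a normalized bump preserves its
Lipschitz constant. -/
theorem ContDiffBump.lipschitzWith_normed_convolution {E : Type*} [NormedAddCommGroup E]
    [NormedSpace ℝ E] [FiniteDimensional ℝ E] [MeasurableSpace E] [BorelSpace E]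
    {μ : Measure E} [μ.IsAddHaarMeasure] (φ : ContDiffBump (0 : E)) {g : E → ℝ} {K : NNReal}
    (hg : LipschitzWith K g) :
    LipschitzWith K (convolution (φ.normed μ) g (ContinuousLinearMap.lsmul ℝ ℝ) μ) := by
  have hint : ∀ x, Integrable (fun t => φ.normed μ t * g (x - t)) μ := fun x =>
    (φ.continuous_normed.mul (hg.continuous.comp (by fun_prop))).integrable_of_hasCompactSupport
      φ.hasCompactSupport_normed.mul_right
  refine LipschitzWith.of_dist_le_mul fun x y => ?_
  simp only [convolution_def, ContinuousLinearMap.lsmul_apply, smul_eq_mul]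
  rw [dist_eq_norm, ← integral_sub (hint x) (hint y)]
  calc
    _ ≤ ∫ t, φ.normed μ t * (K * dist x y) ∂μ := by
      refine norm_integral_le_of_norm_le (φ.integrable_normed.mul_const _)
        (Filter.Eventually.of_forall fun t => ?_)
      rw [← mul_sub, norm_mul, Real.norm_of_nonneg (φ.nonneg_normed t), ← dist_eq_norm]
      refine mul_le_mul_of_nonneg_left ?_ (φ.nonneg_normed t)
      simpa using hg.dist_le_mul (x - t) (y - t)
    _ = K * dist x y := by rw [integral_mul_const, φ.integral_normed, one_mul]

open MeasureTheory Metric in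
/-- The average of a continuous function with values in `[a, b]` against a normalized bump
has values in `[a, b]`. -/
theorem ContDiffBump.normed_convolution_mem_Icc {E : Type*} [NormedAddCommGroup E]
    [NormedSpace ℝ E] [FiniteDimensional ℝ E] [MeasurableSpace E] [BorelSpace E]
    {μ : Measure E} [μ.IsAddHaarMeasure] (φ : ContDiffBump (0 : E)) {g : E → ℝ} {a b : ℝ}
    (hg : Continuous g) (hab : ∀ x, g x ∈ Set.Icc a b) (x : E) :
    convolution (φ.normed μ) g (ContinuousLinearMap.lsmul ℝ ℝ) μ x ∈ Set.Icc a b := by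
  have hint : Integrable (fun t => φ.normed μ t * g (x - t)) μ :=
    (φ.continuous_normed.mul (hg.comp (by fun_prop))).integrable_of_hasCompactSupport
      φ.hasCompactSupport_normed.mul_right
  have hconst : ∀ c : ℝ, ∫ t, φ.normed μ t * c ∂μ = c := fun c => by
    rw [integral_mul_const, φ.integral_normed, one_mul]
  simp only [convolution_def, ContinuousLinearMap.lsmul_apply, smul_eq_mul]
  constructor
  · rw [← hconst a]
    exact integral_mono (φ.integrable_normed.mul_const _) hint fun t =>
      mul_le_mul_of_nonneg_left (hab _).1 (φ.nonneg_normed t)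
  · rw [← hconst b]
    exact integral_mono hint (φ.integrable_normed.mul_const _) fun t =>
      mul_le_mul_of_nonneg_left (hab _).2 (φ.nonneg_normed t)

open MeasureTheory Metric in
/-- For every natural number `d` there exists a constant `C_d > 0` such that for every
closed subset `F` of `ℝ^d` and every positive integer `ν` there is a smooth function
`χ : ℝ^d → ℝ` with values in `[0,1]`, equal to `1` whenever `dist(x, F) ≥ 1/ν`,
vanishing on an open neighborhood of `F`, and with `‖Dχ(x)‖ ≤ C_d · ν` everywhere. -/
theorem cutoff_with_controlled_gradient (d : ℕ) :
    ∃ C : ℝ, 0 < C ∧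
      ∀ (F : Set (EuclideanSpace ℝ (Fin d))), IsClosed F →
        ∀ ν : ℕ, 0 < ν →
          ∃ χ : EuclideanSpace ℝ (Fin d) → ℝ,
            ContDiff ℝ (⊤ : ℕ∞) χ ∧
            (∀ x, χ x ∈ Set.Icc (0 : ℝ) 1) ∧
            (∀ x, (1 : ℝ) / ν ≤ Metric.infDist x F → χ x = 1) ∧
            (∃ U : Set (EuclideanSpace ℝ (Fin d)),
              IsOpen U ∧ F ⊆ U ∧ ∀ x ∈ U, χ x = 0) ∧
            (∀ x, ‖fderiv ℝ χ x‖ ≤ C * ν) := by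
  refine ⟨3, by norm_num, fun F _ ν hν => ?_⟩
  have hν' : (0 : ℝ) < ν := Nat.cast_pos.2 hν
  set g : EuclideanSpace ℝ (Fin d) → ℝ := fun x => max 0 (min 1 (3 * ν * infDist x F - 1))
    with hg_def
  have hg : LipschitzWith (3 * ν) g := by
    refine LipschitzWith.const_max (LipschitzWith.const_min ?_ 1) 0
    refine LipschitzWith.of_dist_le_mul fun x y => ?_
    have h := (lipschitz_infDist_pt F).dist_le_mul x y
    rw [Real.dist_eq] at h ⊢
    rw [show 3 * (ν : ℝ) * infDist x F - 1 - (3 * ν * infDist y F - 1)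
      = 3 * ν * (infDist x F - infDist y F) by ring, abs_mul, abs_of_pos (by positivity)]
    push_cast
    gcongr
    simpa using h
  have hg_one : ∀ x, 2 ≤ 3 * ν * infDist x F → g x = 1 := fun x hx => by
    rw [hg_def]; dsimp only
    rw [min_eq_left (by linarith), max_eq_right zero_le_one]
  have hg_zero : ∀ x, 3 * ν * infDist x F ≤ 1 → g x = 0 := fun x hx => by
    rw [hg_def]; dsimp only
    exact max_eq_left ((min_le_right _ _).trans (by linarith))
  let φ : ContDiffBump (0 : EuclideanSpace ℝ (Fin d)) :=
    ⟨1 / (12 * ν), 1 / (6 * ν), by positivity, by gcongr; norm_num⟩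
  have hball : ∀ x, ∀ y ∈ ball x φ.rOut,
      |3 * ν * infDist y F - 3 * ν * infDist x F| ≤ 1 / 2 := fun x y hy => by
    have h := (lipschitz_infDist_pt F).dist_le_mul y x
    rw [Real.dist_eq, NNReal.coe_one, one_mul] at h
    have h' : dist y x ≤ 1 / (6 * ν) := (mem_ball.1 hy).le
    rw [← mul_sub, abs_mul, abs_of_pos (by positivity)]
    calc 3 * (ν : ℝ) * |infDist y F - infDist x F| ≤ 3 * ν * (1 / (6 * ν)) := by
          gcongr; exact h.trans h'
      _ = 1 / 2 := by field_simp; norm_num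
  have hconst : ∀ x c, (∀ y ∈ ball x φ.rOut, g y = c) →
      convolution (φ.normed volume) g (ContinuousLinearMap.lsmul ℝ ℝ) volume x = c :=
    fun x c h => by
      have hx := h x (mem_ball_self φ.rOut_pos)
      rw [φ.normed_convolution_eq_right fun y hy => (h y hy).trans hx.symm, hx]
  refine ⟨convolution (φ.normed volume) g (ContinuousLinearMap.lsmul ℝ ℝ) volume,
    φ.hasCompactSupport_normed.contDiff_convolution_left _ φ.contDiff_normed
      hg.continuous.locallyIntegrable,
    φ.normed_convolution_mem_Icc hg.continuous fun x =>
      ⟨le_max_left _ _, max_le zero_le_one (min_le_left _ _)⟩,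
    fun x hx => hconst x 1 fun y hy => hg_one y ?_,
    ⟨{x | 3 * ν * infDist x F < 1 / 2}, ?_, fun x hx => ?_,
      fun x hx => hconst x 0 fun y hy => hg_zero y ?_⟩, fun x => ?_⟩
  · have h := (abs_le.1 (hball x y hy)).1
    rw [div_le_iff₀ hν'] at hx
    linarith
  · exact isOpen_lt (continuous_const.mul (continuous_infDist_pt F)) continuous_const
  · simp [infDist_zero_of_mem hx]
  · have h := (abs_le.1 (hball x y hy)).2
    rw [Set.mem_ofPred_eq] at hx
    linarith
  · simpa using norm_fderiv_le_of_lipschitz ℝ (φ.lipschitzWith_normed_convolution hg) (x₀ := x)
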